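/- arXiv:0906.2643 — 2 statements merged into one kernel-verified Lean document; each statement's English description precedes it below -/
import Mathlib

section
/- (Corollary 2.8) Let n = 2m+1 and let h ∈ SO_{2m+1}(F) be semisimple. Then the matrices X ∈ M_n(F) and Y ∈ GL_n(F) of Proposition 2.7 can be chosen so that, in addition to (X, Y) satisfying equation (1.1) and h = -(I_n - X'·Y⁻¹·X), the matrix X is idempotent (X² = X) and X'·Y⁻¹·X = X'·Y⁻¹ = -Y⁻¹·X. -/
open Matrix

/-- The `k × k` antidiagonal matrix `w_k` with `(w_k)_{i, k+1-i} = 1` (1-indexed). -/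
noncomputable def wMat (F : Type*) [Field F] (k : ℕ) : Matrix (Fin k) (Fin k) F :=
  Matrix.of fun i j => if (i : ℕ) + (j : ℕ) = k - 1 then 1 else 0

/-- `ε(g) = w_n · ᵗg⁻¹ · w_n⁻¹`. -/
noncomputable def eps (F : Type*) [Field F] (n : ℕ) (g : Matrix (Fin n) (Fin n) F) :
    Matrix (Fin n) (Fin n) F :=
  wMat F n * (g⁻¹)ᵀ * (wMat F n)⁻¹

/-- `ε̃(Y) = w_n · ᵗY · w_n`. -/
noncomputable def epsTilde (F : Type*) [Field F] (n : ℕ) (Y : Matrix (Fin n) (Fin n) F) :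
    Matrix (Fin n) (Fin n) F :=
  wMat F n * Yᵀ * wMat F n

/-- `X' = -w_{2m+1} · ᵗX · w_n`. -/
noncomputable def Xpr (F : Type*) [Field F] (n m : ℕ)
    (X : Matrix (Fin n) (Fin (2 * m + 1)) F) : Matrix (Fin (2 * m + 1)) (Fin n) F :=
  -(wMat F (2 * m + 1)) * Xᵀ * wMat F n

/-- Equation (1.1): `Y + ε̃(Y) = X·X'`. -/
def Eq11 (F : Type*) [Field F] (n m : ℕ)
    (X : Matrix (Fin n) (Fin (2 * m + 1)) F) (Y : Matrix (Fin n) (Fin n) F) : Prop :=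
  Y + epsTilde F n Y = X * Xpr F n m X

/-- Membership in `SO_{2m+1}(F)`: `h · w_{2m+1} · ᵗh = w_{2m+1}` and `det h = 1`. -/
def SOw (F : Type*) [Field F] (k : ℕ) (h : Matrix (Fin k) (Fin k) F) : Prop :=
  h * wMat F k * hᵀ = wMat F k ∧ h.det = 1

section Adjoint

variable {F : Type*} [Field F] {n : ℕ}

theorem wMat_transpose : (wMat F n)ᵀ = wMat F n := by
  ext i j
  simp [wMat, add_comm]

theorem wMat_mul_self : wMat F n * wMat F n = 1 := by
  ext i j
  have hi := i.isLt
  have hj := j.isLt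
  rw [Matrix.mul_apply, Finset.sum_eq_single (Fin.rev i)]
  · simp only [wMat, Matrix.of_apply, Fin.val_rev, Matrix.one_apply, Fin.ext_iff]
    rw [if_pos (by omega), one_mul]
    exact if_congr (by omega) rfl rfl
  · intro k _ hk
    have hk' : ¬ (i : ℕ) + k = n - 1 := fun e => hk (Fin.ext (by rw [Fin.val_rev]; omega))
    simp [wMat, hk']
  · simp

theorem epsTilde_mul (A B : Matrix (Fin n) (Fin n) F) :
    epsTilde F n (A * B) = epsTilde F n B * epsTilde F n A := by
  simp only [epsTilde, Matrix.transpose_mul]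
  calc _ = wMat F n * Bᵀ * 1 * (Aᵀ * wMat F n) := by noncomm_ring
    _ = _ := by rw [← wMat_mul_self]; noncomm_ring

theorem epsTilde_add (A B : Matrix (Fin n) (Fin n) F) :
    epsTilde F n (A + B) = epsTilde F n A + epsTilde F n B := by
  simp [epsTilde, mul_add, add_mul]

theorem epsTilde_neg (A : Matrix (Fin n) (Fin n) F) :
    epsTilde F n (-A) = -epsTilde F n A := by
  simp [epsTilde]

theorem epsTilde_sub (A B : Matrix (Fin n) (Fin n) F) :
    epsTilde F n (A - B) = epsTilde F n A - epsTilde F n B := by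
  rw [sub_eq_add_neg, epsTilde_add, epsTilde_neg, sub_eq_add_neg]

theorem epsTilde_one : epsTilde F n 1 = 1 := by
  simp [epsTilde, wMat_mul_self]

theorem epsTilde_epsTilde (A : Matrix (Fin n) (Fin n) F) :
    epsTilde F n (epsTilde F n A) = A := by
  simp only [epsTilde, Matrix.transpose_mul, wMat_transpose, Matrix.transpose_transpose]
  calc _ = (wMat F n * wMat F n) * A * (wMat F n * wMat F n) := by noncomm_ring
    _ = A := by simp [wMat_mul_self]

theorem det_epsTilde (A : Matrix (Fin n) (Fin n) F) : (epsTilde F n A).det = A.det := by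
  have hw := congrArg Matrix.det (wMat_mul_self (F := F) (n := n))
  rw [Matrix.det_mul, Matrix.det_one] at hw
  rw [epsTilde, Matrix.det_mul, Matrix.det_mul, Matrix.det_transpose]
  linear_combination A.det * hw

/-- An isometry for which `-1` is not an eigenvalue has determinant one. -/
theorem det_eq_one_of_isUnit_one_add {g : Matrix (Fin n) (Fin n) F}
    (hg : g * epsTilde F n g = 1) (hu : IsUnit (1 + g)) : g.det = 1 := by
  have e : 1 + g = g * epsTilde F n (1 + g) := by
    rw [epsTilde_add, epsTilde_one, mul_add, hg, mul_one, add_comm]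
  have e' := congrArg Matrix.det e
  rw [Matrix.det_mul, det_epsTilde] at e'
  have hne : (1 + g).det ≠ 0 := ((Matrix.isUnit_iff_isUnit_det _).1 hu).ne_zero
  exact mul_right_cancel₀ hne (by rw [← e', one_mul])

end Adjoint

/-- Rank factorization of an idempotent matrix. -/
theorem exists_factor_of_isIdempotentElem {F : Type*} [Field F] {n : ℕ}
    {P : Matrix (Fin n) (Fin n) F} (hP : P * P = P) :
    ∃ (r : ℕ) (U : Matrix (Fin n) (Fin r) F) (V : Matrix (Fin r) (Fin n) F),
      U * V = P ∧ V * U = 1 := by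
  let f := Matrix.toLin' P
  let b := Module.finBasis F (LinearMap.range f)
  let e := Pi.basisFun F (Fin n)
  refine ⟨_, LinearMap.toMatrix b e (LinearMap.range f).subtype,
    LinearMap.toMatrix e b f.rangeRestrict, ?_, ?_⟩
  · rw [← LinearMap.toMatrix_comp, LinearMap.subtype_comp_codRestrict]
    exact LinearMap.toMatrix'_toLin' P
  · rw [← LinearMap.toMatrix_comp, ← LinearMap.toMatrix_id b]
    congr 1
    ext ⟨_, y, rfl⟩ : 2
    simp [f, hP]

/-- A squarefree annihilating polynomial splits off the kernel of `1 + h` through an idempotent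
`P`. -/
theorem exists_projection_of_squarefree_minpoly {F R : Type*} [Field F] [Ring R] [Algebra F R]
    {h : R} (hss : Squarefree (minpoly F h)) :
    ∃ P r : R, h * P = -P ∧ P * h = -P ∧ (1 + h) * r = 1 - P ∧ r * (1 + h) = 1 - P ∧
      (∀ Z : R, h * Z = -Z → P * Z = Z) := by
  open Polynomial in
  have key : ∃ q : F[X], q.eval (-1) = 1 ∧ aeval h ((X + 1) * q) = 0 := by
    by_cases hr : (minpoly F h).eval (-1) = 0
    · obtain ⟨q, hq⟩ := dvd_iff_isRoot.2 hr
      have hX : (X - C (-1) : F[X]) = X + 1 := by simp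
      rw [hX] at hq
      have hq1 : q.eval (-1) ≠ 0 := by
        intro h0
        obtain ⟨s, hs⟩ := dvd_iff_isRoot.2 h0
        rw [hX] at hs
        have hu := hss (X + 1) ⟨s, by rw [hq, hs, mul_assoc]⟩
        have := natDegree_eq_zero_of_isUnit hu
        rw [← C_1, natDegree_X_add_C] at this
        exact one_ne_zero this
      refine ⟨C (q.eval (-1))⁻¹ * q, by simp [hq1], ?_⟩
      rw [mul_left_comm, ← hq, map_mul, minpoly.aeval, mul_zero]
    · refine ⟨C ((minpoly F h).eval (-1))⁻¹ * minpoly F h, by simp [hr], ?_⟩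
      simp
  open Polynomial in
  obtain ⟨q, hq1, hq⟩ := key
  have hroot : (1 - q).IsRoot (-1) := by simp [hq1]
  obtain ⟨r, hr⟩ := dvd_iff_isRoot.2 hroot
  have hX : (X - C (-1) : F[X]) = X + 1 := by simp
  rw [hX] at hr
  have h1 : (h + 1) * aeval h q = 0 := by simpa using hq
  have h2 : aeval h q * (h + 1) = 0 := by
    rw [mul_comm] at hq
    simpa using hq
  have h3 : 1 - aeval h q = (h + 1) * aeval h r := by simpa using congrArg (aeval h) hr
  have h4 : 1 - aeval h q = aeval h r * (h + 1) := by
    rw [mul_comm] at hr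
    simpa using congrArg (aeval h) hr
  refine ⟨aeval h q, aeval h r, ?_, ?_, ?_, ?_, ?_⟩
  · rw [add_mul, one_mul] at h1
    exact eq_neg_of_add_eq_zero_left h1
  · rw [mul_add, mul_one] at h2
    exact eq_neg_of_add_eq_zero_left h2
  · rw [add_comm, h3]
  · rw [add_comm, h4]
  · intro Z hZ
    have : (1 - aeval h q) * Z = 0 := by
      rw [h4, mul_assoc, add_mul, hZ, one_mul, neg_add_cancel, mul_zero]
    rw [sub_mul, one_mul] at this
    exact (sub_eq_zero.1 this).symm

/-- Gluing an inverse on the range of `1 - P` with an inverse on the range of `P`. -/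
theorem isUnit_one_add_add {R : Type*} [Ring R] {h P r B C : R}
    (hP1 : h * P = -P) (hP2 : P * h = -P) (hr1 : (1 + h) * r = 1 - P) (hr2 : r * (1 + h) = 1 - P)
    (hPP : P * P = P) (hPB : P * B = B) (hBP : B * P = B) (hPC : P * C = C) (hCP : C * P = C)
    (hBC : B * C = P) (hCB : C * B = P) : IsUnit (1 + h + B) := by
  have z1 : (1 + h) * C = 0 := by
    rw [← hPC, ← mul_assoc, add_mul, hP1, one_mul, add_neg_cancel, zero_mul]
  have z2 : C * (1 + h) = 0 := by
    rw [← hCP, mul_assoc, mul_add, hP2, mul_one, add_neg_cancel, mul_zero]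
  have z3 : P * (1 + h) = 0 := by rw [mul_add, hP2, mul_one, add_neg_cancel]
  refine ⟨⟨1 + h + B, (1 - P) * r * (1 - P) + C, ?_, ?_⟩, rfl⟩
  · calc (1 + h + B) * ((1 - P) * r * (1 - P) + C)
        = ((1 + h) * r - (1 + h) * P * r) * (1 - P) + (1 + h) * C
          + (B - B * P) * (r * (1 - P)) + B * C := by noncomm_ring
      _ = 1 := by
        rw [hr1, z1, hBP, hBC, add_mul, hP1]
        simp [mul_sub, sub_mul, hPP]
  · calc ((1 - P) * r * (1 - P) + C) * (1 + h + B)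
        = (1 - P) * (r * (1 + h) - r * (P * (1 + h))) + C * (1 + h)
          + (1 - P) * r * (B - P * B) + C * B := by noncomm_ring
      _ = 1 := by
        rw [hr2, z2, hPB, hCB, z3]
        simp [mul_sub, sub_mul, hPP]

/-- A self-adjoint idempotent of even rank is the support of a skew-adjoint matrix. -/
theorem exists_skew_of_det_eq_one {F : Type*} [Field F] [CharZero F] {n : ℕ}
    {P : Matrix (Fin n) (Fin n) F} (hP : P * P = P) (hPs : epsTilde F n P = P)
    (hdet : (1 - 2 * P).det = 1) :
    ∃ B C : Matrix (Fin n) (Fin n) F, epsTilde F n B = -B ∧ P * B = B ∧ B * P = B ∧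
      P * C = C ∧ C * P = C ∧ B * C = P ∧ C * B = P := by
  obtain ⟨r, U, V, hUV, hVU⟩ := exists_factor_of_isIdempotentElem hP
  have hr : Even r := by
    have e : (1 - 2 * P) = 1 + U * ((-2 : F) • V) := by
      rw [Matrix.mul_smul, hUV, neg_smul, two_smul, two_mul, sub_eq_add_neg]
    have e2 : (1 + ((-2 : F) • V) * U) = -(1 : Matrix (Fin r) (Fin r) F) := by
      rw [Matrix.smul_mul, hVU, neg_smul, two_smul]
      abel
    rw [e, Matrix.det_one_add_mul_comm, e2, Matrix.det_neg, Matrix.det_one, mul_one,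
      Fintype.card_fin] at hdet
    by_contra hodd
    rw [Nat.not_even_iff_odd] at hodd
    rw [hodd.neg_one_pow] at hdet
    norm_num at hdet
  obtain ⟨k, rfl⟩ := hr
  let J : Matrix (Fin (k + k)) (Fin (k + k)) F :=
    Matrix.reindexAlgEquiv F F finSumFinEquiv (Matrix.J (Fin k) F)
  have hJ2 : J * J = -1 := by
    rw [← map_mul, Matrix.J_squared, map_neg, map_one]
  have hJt : Jᵀ = -J := by
    rw [← map_neg, ← Matrix.J_transpose]
    rfl
  have hPw : P * wMat F n = wMat F n * Pᵀ := by
    conv_lhs => rw [← hPs, epsTilde, mul_assoc, wMat_mul_self, mul_one]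
  have hwP : wMat F n * P = Pᵀ * wMat F n := by
    conv_lhs => rw [← hPs, epsTilde, ← mul_assoc, ← mul_assoc, wMat_mul_self, one_mul]
  have hVP : V * P = V := by rw [← hUV, ← Matrix.mul_assoc, hVU, Matrix.one_mul]
  have hPU : P * U = U := by rw [← hUV, Matrix.mul_assoc, hVU, Matrix.mul_one]
  have hVPt : Pᵀ * Vᵀ = Vᵀ := by rw [← Matrix.transpose_mul, hVP]
  have hPUt : Uᵀ * Pᵀ = Uᵀ := by rw [← Matrix.transpose_mul, hPU]
  have hVUt : Uᵀ * Vᵀ = 1 := by rw [← Matrix.transpose_mul, hVU, Matrix.transpose_one]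
  have hUVt : Vᵀ * Uᵀ = Pᵀ := by rw [← Matrix.transpose_mul, hUV]
  refine ⟨wMat F n * (Vᵀ * J * V), -(U * J * Uᵀ) * wMat F n, ?_, ?_, ?_, ?_, ?_, ?_, ?_⟩
  · rw [epsTilde, Matrix.transpose_mul, wMat_transpose, mul_assoc, mul_assoc, wMat_mul_self,
      mul_one, Matrix.transpose_mul, Matrix.transpose_mul, hJt, Matrix.transpose_transpose]
    simp [Matrix.mul_assoc]
  · rw [← mul_assoc, hPw, mul_assoc, Matrix.mul_assoc Vᵀ, ← Matrix.mul_assoc Pᵀ, hVPt]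
  · rw [mul_assoc, Matrix.mul_assoc, hVP]
  · rw [← mul_assoc, mul_neg, ← Matrix.mul_assoc, ← Matrix.mul_assoc, hPU]
  · rw [mul_assoc, hwP, ← mul_assoc, neg_mul, Matrix.mul_assoc, hPUt]
  · calc wMat F n * (Vᵀ * J * V) * (-(U * J * Uᵀ) * wMat F n)
        = -(wMat F n * (Vᵀ * (J * (V * U) * J) * Uᵀ) * wMat F n) := by
          simp only [Matrix.mul_assoc, Matrix.mul_neg, Matrix.neg_mul]
      _ = P := by
          rw [hVU, Matrix.mul_one, hJ2, Matrix.mul_neg, Matrix.mul_one, Matrix.neg_mul, hUVt,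
            Matrix.mul_neg, Matrix.neg_mul, neg_neg]
          exact hPs
  · calc -(U * J * Uᵀ) * wMat F n * (wMat F n * (Vᵀ * J * V))
        = -(U * J * Uᵀ * (wMat F n * wMat F n) * (Vᵀ * J * V)) := by
          simp only [Matrix.mul_assoc, Matrix.neg_mul]
      _ = -(U * (J * (Uᵀ * Vᵀ) * J) * V) := by
          rw [wMat_mul_self]
          simp only [Matrix.mul_assoc, Matrix.one_mul]
      _ = P := by
          rw [hVUt, Matrix.mul_one, hJ2, Matrix.mul_neg, Matrix.mul_one, Matrix.neg_mul, hUV,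
            neg_neg]

/-- Corollary 2.8: for `n = 2m+1` and `h ∈ SO_{2m+1}(F)` semisimple, the
matrices `X`, `Y` of Proposition 2.7 can be chosen with `X` idempotent and
`X'Y⁻¹X = X'Y⁻¹ = -Y⁻¹X`. -/
theorem corollary_2_8 (F : Type*) [Field F] [CharZero F] (m : ℕ)
    (h : Matrix (Fin (2 * m + 1)) (Fin (2 * m + 1)) F) (hSO : SOw F (2 * m + 1) h)
    (hss : Squarefree (minpoly F h)) :
    ∃ (Y X : Matrix (Fin (2 * m + 1)) (Fin (2 * m + 1)) F),
      IsUnit Y ∧ Eq11 F (2 * m + 1) m X Y ∧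
      h = -(1 - Xpr F (2 * m + 1) m X * Y⁻¹ * X) ∧
      X * X = X ∧
      Xpr F (2 * m + 1) m X * Y⁻¹ * X = Xpr F (2 * m + 1) m X * Y⁻¹ ∧
      Xpr F (2 * m + 1) m X * Y⁻¹ = -(Y⁻¹ * X) := by
  have hh : h * epsTilde F _ h = 1 := by
    rw [epsTilde, ← mul_assoc, ← mul_assoc, hSO.1, wMat_mul_self]
  obtain ⟨P, r, hP1, hP2, hr1, hr2, hPZ⟩ := exists_projection_of_squarefree_minpoly hss
  have hPP : P * P = P := hPZ P hP1
  have hPs : epsTilde F _ P = P := by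
    have e1 : epsTilde F _ h * epsTilde F _ P = -epsTilde F _ P := by
      rw [← epsTilde_mul, hP2, epsTilde_neg]
    have e2 : h * epsTilde F _ P = -epsTilde F _ P := by
      have := congrArg (h * ·) e1
      simp only [← mul_assoc, hh, one_mul, mul_neg] at this
      exact neg_eq_iff_eq_neg.1 this.symm
    have e3 := hPZ _ e2
    have e4 := congrArg (epsTilde F _) e3
    rw [epsTilde_mul, epsTilde_epsTilde, e3] at e4
    exact e4
  have hdet : (1 - 2 * P).det = 1 := by
    have hg : (h * (1 - 2 * P)).det = 1 := by
      have hrefl : (1 - 2 * P) * (1 - 2 * P) = 1 := by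
        calc (1 - 2 * P) * (1 - 2 * P) = 1 - 4 * P + 4 * (P * P) := by noncomm_ring
          _ = 1 := by rw [hPP]; abel
      apply det_eq_one_of_isUnit_one_add
      · have : epsTilde F _ (1 - 2 * P) = 1 - 2 * P := by
          rw [two_mul P, epsTilde_sub, epsTilde_add, epsTilde_one, hPs]
        rw [epsTilde_mul, this]
        calc h * (1 - 2 * P) * ((1 - 2 * P) * epsTilde F _ h)
            = h * ((1 - 2 * P) * (1 - 2 * P)) * epsTilde F _ h := by noncomm_ring
          _ = 1 := by rw [hrefl, mul_one, hh]
      · have e : 1 + h * (1 - 2 * P) = 1 + h + (2 : F) • P := by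
          rw [two_mul P, mul_sub, mul_add, hP1, two_smul]
          noncomm_ring
        rw [e]
        apply isUnit_one_add_add (C := (2⁻¹ : F) • P) hP1 hP2 hr1 hr2 hPP <;>
          simp [hPP, smul_smul]
    rwa [Matrix.det_mul, hSO.2, one_mul] at hg
  obtain ⟨B, C, hBs, hPB, hBP, hPC, hCP, hBC, hCB⟩ := exists_skew_of_det_eq_one hPP hPs hdet
  have hA : IsUnit (1 + h + B) := isUnit_one_add_add hP1 hP2 hr1 hr2 hPP hPB hBP hPC hCP hBC hCB
  set A := -(1 + h + B) with hAdef
  have hAdet : IsUnit A.det := (Matrix.isUnit_iff_isUnit_det _).1 hA.neg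
  have hAX : A * (1 - P) = -(1 + h) := by
    calc A * (1 - P) = -(1 + h) + (P + h * P) + (B * P - B) := by rw [hAdef]; noncomm_ring
      _ = _ := by rw [hP1, hBP]; simp
  have hXA : (1 - P) * A = -(1 + h) := by
    calc (1 - P) * A = -(1 + h) + (P + P * h) + (P * B - B) := by rw [hAdef]; noncomm_ring
      _ = _ := by rw [hP2, hPB]; simp
  have hXX : (1 - P) * (1 - P) = 1 - P := by simp [mul_sub, sub_mul, hPP]
  have hXpr : Xpr F (2 * m + 1) m (1 - P) = -(1 - P) := by
    have : Xpr F (2 * m + 1) m (1 - P) = -epsTilde F _ (1 - P) := by simp [Xpr, epsTilde]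
    rw [this, epsTilde_sub, epsTilde_one, hPs]
  have hYA : A⁻¹⁻¹ = A := Matrix.nonsing_inv_nonsing_inv A hAdet
  refine ⟨A⁻¹, 1 - P, ?_, ?_, ?_, hXX, ?_, ?_⟩
  · exact (Matrix.isUnit_nonsing_inv_iff).2 hA.neg
  · have hAA : A * A⁻¹ = 1 := Matrix.mul_nonsing_inv A hAdet
    have hAA' : A⁻¹ * A = 1 := Matrix.nonsing_inv_mul A hAdet
    have hAs : epsTilde F _ A⁻¹ * epsTilde F _ A = 1 := by
      rw [← epsTilde_mul, hAA, epsTilde_one]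
    have hAs' : epsTilde F _ A * epsTilde F _ A⁻¹ = 1 := by
      rw [← epsTilde_mul, hAA', epsTilde_one]
    have hXs : epsTilde F _ (1 - P) = 1 - P := by rw [epsTilde_sub, epsTilde_one, hPs]
    have hsum : epsTilde F _ A + A = -(A * (1 - P) * ((1 - P) * epsTilde F _ A)) := by
      have : (1 - P) * epsTilde F _ A = -(1 + epsTilde F _ h) := by
        rw [← hXs, ← epsTilde_mul, hAX, epsTilde_neg, epsTilde_add, epsTilde_one]
      rw [this, hAX]
      calc epsTilde F _ A + A = -(1 + epsTilde F _ h + h + 1) := by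
            rw [hAdef, epsTilde_neg, epsTilde_add, epsTilde_add, epsTilde_one, hBs]
            abel
        _ = -(1 + epsTilde F _ h + h + h * epsTilde F _ h) := by rw [hh]
        _ = _ := by noncomm_ring
    rw [Eq11, hXpr, mul_neg]
    calc A⁻¹ + epsTilde F _ A⁻¹
        = A⁻¹ * (epsTilde F _ A * epsTilde F _ A⁻¹) + (A⁻¹ * A) * epsTilde F _ A⁻¹ := by
          rw [hAs', hAA', mul_one, one_mul]
      _ = A⁻¹ * (epsTilde F _ A + A) * epsTilde F _ A⁻¹ := by noncomm_ring
      _ = -((A⁻¹ * A) * ((1 - P) * (1 - P)) * (epsTilde F _ A * epsTilde F _ A⁻¹)) := by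
          rw [hsum]; simp only [mul_assoc, mul_neg, neg_mul]
      _ = _ := by rw [hAA', hAs', one_mul, mul_one]
  · rw [hXpr, hYA, neg_mul, hXA, neg_neg, add_mul, one_mul, mul_sub, hP1]
    noncomm_ring
  · rw [hXpr, hYA, mul_assoc, hAX, neg_mul, neg_mul, hXA, mul_neg, neg_neg, neg_neg, sub_mul,
      one_mul, mul_add, hP2, mul_one, add_neg_cancel, sub_zero]
  · rw [hXpr, hYA, hAX, neg_mul, hXA]
end

section
/- (Lemma 3.1) Let n = 2m with m ≥ 1, and let h ∈ SO_{2m+1}(F) be semisimple. Then there exist Y ∈ GL_{2m}(F) and X ∈ M_{2m×(2m+1)}(F) such that Y + ε̃(Y) = X·X' and I_{2m+1} - X'·Y⁻¹·X is conjugate to h by an element of SO_{2m+1}(F). -/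
open Matrix

/-- Every square matrix over a field is a product `A * B` in which `A` has a left inverse and `B`
has a right inverse. -/
theorem Matrix.exists_full_rank_factorization {F n : Type*} [Field F] [Fintype n] [DecidableEq n]
    (N : Matrix n n F) :
    ∃ (r : ℕ) (A : Matrix n (Fin r) F) (B : Matrix (Fin r) n F) (L : Matrix (Fin r) n F)
      (R : Matrix n (Fin r) F), r ≤ Fintype.card n ∧ N = A * B ∧ L * A = 1 ∧ B * R = 1 := by
  set f := Matrix.toLin' N with hf
  let b := Module.finBasis F (LinearMap.range f)
  obtain ⟨g, hg⟩ := f.range.subtype.exists_leftInverse_of_injective f.range.ker_subtype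
  obtain ⟨s, hs⟩ := f.rangeRestrict.exists_rightInverse_of_surjective f.range_rangeRestrict
  let c := Pi.basisFun F n
  refine ⟨_, LinearMap.toMatrix b c f.range.subtype, LinearMap.toMatrix c b f.rangeRestrict,
    LinearMap.toMatrix c b g, LinearMap.toMatrix b c s, ?_, ?_, ?_, ?_⟩
  · simpa using Submodule.finrank_le f.range
  · rw [← LinearMap.toMatrix_comp, LinearMap.subtype_comp_codRestrict, hf]
    exact (LinearMap.toMatrix'_toLin' N).symm
  · rw [← LinearMap.toMatrix_comp, hg, LinearMap.toMatrix_id]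
  · rw [← LinearMap.toMatrix_comp, hs, LinearMap.toMatrix_id]

/-- An isometry `h` of a symmetric form `W` with `W * W = 1` is given by its Wall form `D` on the
range of `h - 1`. -/
theorem Matrix.exists_wall_form {F n : Type*} [Field F] [Fintype n] [DecidableEq n]
    {W h : Matrix n n F} (hWt : Wᵀ = W) (hWW : W * W = 1) (hh : h * W * hᵀ = W) :
    ∃ (r : ℕ) (B : Matrix (Fin r) n F) (D : Matrix (Fin r) (Fin r) F), r ≤ Fintype.card n ∧
      IsUnit D ∧ h = 1 + W * Bᵀ * D⁻¹ * B ∧ D + Dᵀ = -(B * W * Bᵀ) := by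
  obtain ⟨r, A, B, L, R, hr, hAB, hLA, hBR⟩ := Matrix.exists_full_rank_factorization (h - 1)
  have hh' : h = 1 + A * B := by rw [← hAB]; abel
  have hLAt : Aᵀ * Lᵀ = 1 := by rw [← transpose_mul, hLA, transpose_one]
  have hBRt : Rᵀ * Bᵀ = 1 := by rw [← transpose_mul, hBR, transpose_one]
  have hrel : A * B * W + W * Bᵀ * Aᵀ + A * B * W * Bᵀ * Aᵀ = 0 := by
    have : (1 + A * B) * W * (1 + A * B)ᵀ = W := by rw [← hh', hh]
    simp only [transpose_add, transpose_one, transpose_mul, Matrix.mul_add, Matrix.add_mul,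
      Matrix.one_mul, Matrix.mul_one, ← Matrix.mul_assoc] at this ⊢
    rw [← sub_eq_zero] at this
    rw [← this]
    abel
  obtain ⟨D, hD⟩ : ∃ D : Matrix (Fin r) (Fin r) F, W * Bᵀ = A * D := by
    refine ⟨-(B * W * hᵀ * Lᵀ), ?_⟩
    have h1 : W * Bᵀ * Aᵀ = -(A * B * W * hᵀ) := by
      rw [hh', eq_neg_iff_add_eq_zero, ← hrel]
      simp only [transpose_add, transpose_one, transpose_mul, Matrix.mul_add,
        Matrix.mul_one, ← Matrix.mul_assoc]
      abel
    calc W * Bᵀ = W * Bᵀ * Aᵀ * Lᵀ := by rw [Matrix.mul_assoc _ Aᵀ, hLAt, Matrix.mul_one]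
      _ = _ := by rw [h1]; simp only [Matrix.mul_neg, Matrix.neg_mul, ← Matrix.mul_assoc]
  have hED : Rᵀ * W * A * D = 1 := by
    rw [Matrix.mul_assoc _ A, ← hD, Matrix.mul_assoc, ← Matrix.mul_assoc W, hWW, Matrix.one_mul,
      hBRt]
  have hDu : IsUnit D := IsUnit.of_mul_eq_one_right _ hED
  have hdet : IsUnit D.det := (Matrix.isUnit_iff_isUnit_det D).1 hDu
  have hdett : IsUnit Dᵀ.det := by rwa [Matrix.det_transpose]
  have hA : A = W * Bᵀ * D⁻¹ := by
    rw [hD, Matrix.mul_assoc, Matrix.mul_nonsing_inv _ hdet, Matrix.mul_one]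
  have hAt : Aᵀ = (Dᵀ)⁻¹ * B * W := by
    rw [hA, transpose_mul, transpose_mul, transpose_transpose, hWt, transpose_nonsing_inv,
      Matrix.mul_assoc]
  refine ⟨r, B, D, hr, hDu, by rw [← hA, hh'], ?_⟩
  have hcancel : D⁻¹ + (Dᵀ)⁻¹ + D⁻¹ * B * W * Bᵀ * (Dᵀ)⁻¹ = 0 := by
    have h1 : W * Bᵀ * (D⁻¹ + (Dᵀ)⁻¹ + D⁻¹ * B * W * Bᵀ * (Dᵀ)⁻¹) * (B * W) = 0 := by
      rw [← hrel, hAt, hA]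
      simp only [Matrix.mul_add, Matrix.add_mul, ← Matrix.mul_assoc]
    have hl : Rᵀ * W * (W * Bᵀ) = 1 := by
      rw [Matrix.mul_assoc, ← Matrix.mul_assoc W, hWW, Matrix.one_mul, hBRt]
    have hr' : B * W * (W * R) = 1 := by
      rw [Matrix.mul_assoc, ← Matrix.mul_assoc W, hWW, Matrix.one_mul, hBR]
    generalize D⁻¹ + (Dᵀ)⁻¹ + D⁻¹ * B * W * Bᵀ * (Dᵀ)⁻¹ = Z at h1 ⊢
    calc Z = (Rᵀ * W * (W * Bᵀ)) * Z * (B * W * (W * R)) := by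
          rw [hl, hr', Matrix.one_mul, Matrix.mul_one]
      _ = Rᵀ * W * (W * Bᵀ * Z * (B * W)) * (W * R) := by simp only [Matrix.mul_assoc]
      _ = 0 := by rw [h1, Matrix.mul_zero, Matrix.zero_mul]
  have h2 : D * (D⁻¹ + (Dᵀ)⁻¹ + D⁻¹ * B * W * Bᵀ * (Dᵀ)⁻¹) * Dᵀ = 0 := by
    rw [hcancel, Matrix.mul_zero, Matrix.zero_mul]
  have h3 : D * (D⁻¹ + (Dᵀ)⁻¹ + D⁻¹ * B * W * Bᵀ * (Dᵀ)⁻¹) * Dᵀ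
      = Dᵀ + D + B * W * Bᵀ := by
    simp only [Matrix.mul_add, Matrix.add_mul, ← Matrix.mul_assoc,
      Matrix.mul_nonsing_inv _ hdet, Matrix.one_mul,
      Matrix.nonsing_inv_mul_cancel_right _ _ hdett]
  rw [eq_neg_iff_add_eq_zero, add_comm D, ← h3, h2]

/-- The determinant of an isometry is the sign of the dimension of its Wall form. -/
theorem Matrix.det_one_add_wall_form {F n ι : Type*} [Field F] [Fintype n] [DecidableEq n]
    [Fintype ι] [DecidableEq ι] {W : Matrix n n F} {B : Matrix ι n F} {D : Matrix ι ι F}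
    (hD : IsUnit D) (hBD : D + Dᵀ = -(B * W * Bᵀ)) :
    (1 + W * Bᵀ * D⁻¹ * B).det = (-1) ^ Fintype.card ι := by
  have hdet : IsUnit D.det := (Matrix.isUnit_iff_isUnit_det D).1 hD
  have hswap : 1 + B * (W * Bᵀ * D⁻¹) = -(Dᵀ * D⁻¹) := by
    have : B * W * Bᵀ = -(D + Dᵀ) := by rw [hBD, neg_neg]
    rw [← Matrix.mul_assoc, ← Matrix.mul_assoc, this, Matrix.neg_mul, Matrix.add_mul,
      Matrix.mul_nonsing_inv _ hdet]
    abel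
  rw [Matrix.det_one_add_mul_comm, hswap, Matrix.det_neg, Matrix.det_mul, Matrix.det_transpose,
    ← Matrix.det_mul, Matrix.mul_nonsing_inv _ hdet, Matrix.det_one, mul_one]

/-- A Wall form can be enlarged by a nondegenerate alternating form without changing the
isometry. -/
theorem Matrix.exists_wall_form_extension {F n : Type*} [Field F] [Fintype n]
    {W : Matrix n n F} {r k N : ℕ} (hN : r + (k + k) = N) {B : Matrix (Fin r) n F}
    {D : Matrix (Fin r) (Fin r) F} (hD : IsUnit D) (hBD : D + Dᵀ = -(B * W * Bᵀ)) :
    ∃ (X : Matrix (Fin N) n F) (Z : Matrix (Fin N) (Fin N) F), IsUnit Z ∧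
      Z + Zᵀ = -(X * W * Xᵀ) ∧ Xᵀ * Z⁻¹ * X = Bᵀ * D⁻¹ * B := by
  have hdet : IsUnit D.det := (Matrix.isUnit_iff_isUnit_det D).1 hD
  let e : Fin r ⊕ (Fin k ⊕ Fin k) ≃ Fin N :=
    Fintype.equivFinOfCardEq (by simp [hN])
  let X₀ : Matrix (Fin r ⊕ (Fin k ⊕ Fin k)) n F := fromRows B 0
  let Z₀ : Matrix (Fin r ⊕ (Fin k ⊕ Fin k)) (Fin r ⊕ (Fin k ⊕ Fin k)) F :=
    fromBlocks D 0 0 (Matrix.J (Fin k) F)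
  have hZ₀ : Z₀ * fromBlocks D⁻¹ 0 0 (-Matrix.J (Fin k) F) = 1 := by
    simp [Z₀, fromBlocks_multiply, Matrix.mul_nonsing_inv _ hdet, Matrix.J_squared]
  have hinv : Z₀⁻¹ = fromBlocks D⁻¹ 0 0 (-Matrix.J (Fin k) F) := Matrix.inv_eq_right_inv hZ₀
  refine ⟨X₀.submatrix e.symm id, Z₀.submatrix e.symm e.symm, ?_, ?_, ?_⟩
  · rw [Matrix.isUnit_submatrix_equiv]
    exact IsUnit.of_mul_eq_one _ hZ₀
  · have h₀ : Z₀ + Z₀ᵀ = -(X₀ * W * X₀ᵀ) := by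
      simp [Z₀, X₀, fromBlocks_transpose, fromBlocks_add, Matrix.J_transpose, transpose_fromRows,
        fromRows_mul, hBD]
      ext (i | i) (j | j) <;> rfl
    have := congrArg (fun M => M.submatrix e.symm e.symm) h₀
    ext i j
    simpa [Matrix.mul_apply] using congrFun (congrFun this i) j
  · have h₀ : X₀ᵀ * Z₀⁻¹ * X₀ = Bᵀ * D⁻¹ * B := by
      rw [hinv]
      simp [X₀, transpose_fromRows, fromCols_mul_fromBlocks, fromCols_mul_fromRows]
    rw [Matrix.inv_submatrix_equiv, transpose_submatrix, Matrix.submatrix_mul_equiv,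
      Matrix.submatrix_mul_equiv, h₀, Matrix.submatrix_id_id]

theorem wMat_transpose_s17 (F : Type*) [Field F] (k : ℕ) : (wMat F k)ᵀ = wMat F k := by
  ext i j
  simp [wMat, add_comm]

theorem wMat_mul_wMat (F : Type*) [Field F] (k : ℕ) : wMat F k * wMat F k = 1 := by
  have hw : wMat F k = (1 : Matrix (Fin k) (Fin k) F).submatrix Fin.revPerm id := by
    ext i j
    simp only [wMat, of_apply, submatrix_apply, one_apply, Fin.ext_iff, Fin.revPerm_apply,
      Fin.val_rev, id]
    congr 1
    simp only [eq_iff_iff]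
    omega
  rw [hw]
  ext i j
  simp [Matrix.mul_apply, one_apply, Fin.rev_eq_iff]

/-- Lemma 3.1: for `n = 2m` (`m ≥ 1`) and `h ∈ SO_{2m+1}(F)` semisimple,
there exist `Y ∈ GL_{2m}(F)` and `X ∈ M_{2m×(2m+1)}(F)` with `Y + ε̃(Y) = XX'` and
`I - X'Y⁻¹X` conjugate to `h` by an element of `SO_{2m+1}(F)`. -/
theorem lemma_3_1 (F : Type*) [Field F] [CharZero F] (m : ℕ) (hm : 1 ≤ m)
    (h : Matrix (Fin (2 * m + 1)) (Fin (2 * m + 1)) F) (hSO : SOw F (2 * m + 1) h)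
    (hss : Squarefree (minpoly F h)) :
    ∃ (Y : Matrix (Fin (2 * m)) (Fin (2 * m)) F)
      (X : Matrix (Fin (2 * m)) (Fin (2 * m + 1)) F),
      IsUnit Y ∧ Eq11 F (2 * m) m X Y ∧
      ∃ k : Matrix (Fin (2 * m + 1)) (Fin (2 * m + 1)) F,
        SOw F (2 * m + 1) k ∧
        k⁻¹ * (1 - Xpr F (2 * m) m X * Y⁻¹ * X) * k = h := by
  have hw := wMat_mul_wMat F (2 * m)
  obtain ⟨r, B, D, hr, hD, hB, hBD⟩ := Matrix.exists_wall_form (wMat_transpose_s17 F (2 * m + 1))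
    (wMat_mul_wMat F (2 * m + 1)) hSO.1
  have hdet := Matrix.det_one_add_wall_form hD hBD
  rw [← hB, hSO.2, Fintype.card_fin] at hdet
  have heven : Even r := by
    by_contra hodd
    rw [(Nat.not_even_iff_odd.1 hodd).neg_one_pow] at hdet
    norm_num [eq_neg_iff_add_eq_zero] at hdet
  obtain ⟨t, rfl⟩ := heven
  rw [Fintype.card_fin] at hr
  obtain ⟨X, Z, hZ, hXZ, hX⟩ := Matrix.exists_wall_form_extension
    (k := m - t) (N := 2 * m) (by omega) hD hBD
  have hwu : IsUnit (wMat F (2 * m)) := IsUnit.of_mul_eq_one _ hw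
  have hwinv : (wMat F (2 * m))⁻¹ = wMat F (2 * m) := Matrix.inv_eq_right_inv hw
  refine ⟨Z * wMat F (2 * m), X, hZ.mul hwu, ?_, 1, ⟨by simp, by simp⟩, ?_⟩
  · rw [Eq11, epsTilde, Xpr, transpose_mul, wMat_transpose_s17, ← Matrix.mul_assoc, hw, Matrix.one_mul,
      ← Matrix.add_mul, hXZ]
    simp only [Matrix.mul_neg, Matrix.neg_mul, ← Matrix.mul_assoc]
  · have hXY : Xpr F (2 * m) m X * (Z * wMat F (2 * m))⁻¹ * X
        = -(wMat F (2 * m + 1) * (Xᵀ * Z⁻¹ * X)) := by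
      rw [Xpr, Matrix.mul_inv_rev, hwinv, ← Matrix.mul_assoc, Matrix.mul_assoc _ _ (wMat F (2 * m)),
        hw, Matrix.mul_one]
      simp only [Matrix.neg_mul, ← Matrix.mul_assoc]
    rw [hXY, hX, hB]
    simp only [inv_one, Matrix.one_mul, Matrix.mul_one, sub_neg_eq_add, ← Matrix.mul_assoc]
end
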